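/- Let B be an infinite set, C = ⋃{Cₙ : n ∈ ω} with each Cₙ countable, Cₙ ⊆ Cₙ₊₁ and C₀ = ∅, let Z and F be closed subsets of ℝ^{B∪C}, and let f, g : ℝ^{B∪C} → ℝ^{B∪C} be continuous B-invariant maps with f(Z) = F, g(F) = Z, (g ∘ f)|Z = id_Z and (f ∘ g)|F = id_F. Suppose that for each n ∈ ω there are continuous maps sₙⁿ⁺¹, rₙⁿ⁺¹ : ℝ^{B∪Cₙ} → ℝ^{B∪Cₙ₊₁} such that: (i) π_{B∪Cₙ} ∘ sₙⁿ⁺¹ = id; (ii) π_{B∪Cₙ} ∘ rₙⁿ⁺¹ = id; (iii) the image of sₙⁿ⁺¹ and π_{B∪Cₙ₊₁}(Z) are functionally separated in ℝ^{B∪Cₙ₊₁}; (iv) the image of rₙⁿ⁺¹ and π_{B∪Cₙ₊₁}(F) are functionally separated in ℝ^{B∪Cₙ₊₁}. Then there exists a homeomorphism H : ℝ^{B∪C} → ℝ^{B∪C} such that π_B ∘ H = π_B and H|Z = f|Z. -/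

import Mathlib

open Set Topology

universe u

/-- Restriction (projection) of `ℝ^A` onto the subproduct `ℝ^D`, `D ⊆ A`. -/
def resTo {A : Type u} (D : Set A) (x : A → ℝ) : ↥D → ℝ := fun d => x d

/-- Restriction (projection) of `ℝ^E` onto `ℝ^D` for `D ⊆ E ⊆ A`. -/
def resSub {A : Type u} {D E : Set A} (h : D ⊆ E) (x : ↥E → ℝ) : ↥D → ℝ :=
  fun d => x ⟨d.1, h d.2⟩

/-- Two sets are functionally separated if some continuous `[0,1]`-valued function
is `0` on the first and `1` on the second. -/
def FunctionallySeparated {X : Type*} [TopologicalSpace X] (P Q : Set X) : Prop :=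
  ∃ φ : X → ℝ, Continuous φ ∧ (∀ x, φ x ∈ Set.Icc (0 : ℝ) 1) ∧
    (∀ p ∈ P, φ p = 0) ∧ (∀ q ∈ Q, φ q = 1)

/-- The homeomorphism `x ↦ x / (1 + |x|)` of the line onto `(-1, 1)`. -/
noncomputable def squash (x : ℝ) : ℝ := x / (1 + |x|)

/-- The inverse of `squash`. -/
noncomputable def unsquash (x : ℝ) : ℝ := x / (1 - |x|)

lemma abs_squash_lt_one (x : ℝ) : |squash x| < 1 := by
  have h : 0 < 1 + |x| := by positivity
  rw [squash, abs_div, abs_of_pos h, div_lt_one h]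
  linarith

lemma unsquash_squash (x : ℝ) : unsquash (squash x) = x := by
  have h : 0 < 1 + |x| := by positivity
  have h1 : 1 - |x| / (1 + |x|) = 1 / (1 + |x|) := by field_simp; ring
  rw [unsquash, squash, abs_div, abs_of_pos h, h1]
  field_simp

lemma squash_unsquash {x : ℝ} (hx : |x| < 1) : squash (unsquash x) = x := by
  have h : 0 < 1 - |x| := by linarith
  have h1 : 1 + |x| / (1 - |x|) = 1 / (1 - |x|) := by field_simp; ring
  rw [unsquash, squash, abs_div, abs_of_pos h, h1]
  field_simp

lemma squash_zero : squash 0 = 0 := by simp [squash]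

lemma unsquash_zero : unsquash 0 = 0 := by simp [unsquash]

lemma continuous_squash : Continuous squash := by
  unfold squash
  exact continuous_id.div (by fun_prop) fun x => by positivity

lemma continuousAt_unsquash {x : ℝ} (hx : |x| < 1) : ContinuousAt unsquash x := by
  unfold unsquash
  exact continuousAt_id.div (by fun_prop) (by linarith)

/-- The supremum of `2⁻ⁿ aₙ`. -/
noncomputable def dyadicSup (a : ℕ → ℝ) : ℝ := ⨆ n, (1 / 2 : ℝ) ^ n * a n

section DyadicSup

variable {a : ℕ → ℝ}

lemma dyadic_mul_le (ha : ∀ n, a n ∈ Icc (0 : ℝ) 1) (n : ℕ) :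
    (1 / 2 : ℝ) ^ n * a n ≤ (1 / 2 : ℝ) ^ n :=
  mul_le_of_le_one_right (by positivity) (ha n).2

lemma bddAbove_dyadic (ha : ∀ n, a n ∈ Icc (0 : ℝ) 1) :
    BddAbove (range fun n => (1 / 2 : ℝ) ^ n * a n) := by
  refine ⟨1, ?_⟩
  rintro _ ⟨n, rfl⟩
  exact (dyadic_mul_le ha n).trans (pow_le_one₀ (by norm_num) (by norm_num))

lemma le_dyadicSup (ha : ∀ n, a n ∈ Icc (0 : ℝ) 1) (n : ℕ) :
    (1 / 2 : ℝ) ^ n * a n ≤ dyadicSup a :=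
  le_ciSup (bddAbove_dyadic ha) n

lemma dyadicSup_nonneg (ha : ∀ n, a n ∈ Icc (0 : ℝ) 1) : 0 ≤ dyadicSup a :=
  (mul_nonneg (by positivity) (ha 0).1).trans (le_dyadicSup ha 0)

lemma dyadicSup_le {b : ℝ} (h : ∀ n, (1 / 2 : ℝ) ^ n * a n ≤ b) : dyadicSup a ≤ b :=
  ciSup_le h

lemma exists_half_pow_lt {b : ℝ} (hb : 0 < b) : ∃ N : ℕ, (1 / 2 : ℝ) ^ N < b :=
  exists_pow_lt_of_lt_one hb (by norm_num)

lemma half_pow_anti {m n : ℕ} (h : m ≤ n) : (1 / 2 : ℝ) ^ n ≤ (1 / 2 : ℝ) ^ m :=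
  pow_le_pow_of_le_one (by norm_num) (by norm_num) h

lemma dyadicSup_lt (ha : ∀ n, a n ∈ Icc (0 : ℝ) 1) {b : ℝ} (hb : 0 < b)
    (h : ∀ n, (1 / 2 : ℝ) ^ n * a n < b) : dyadicSup a < b := by
  obtain ⟨N, hN⟩ := exists_half_pow_lt (half_pos hb)
  obtain ⟨m, -, hm⟩ := Finset.exists_max_image (Finset.range (N + 1))
    (fun n => (1 / 2 : ℝ) ^ n * a n) ⟨0, by simp⟩
  refine (dyadicSup_le (b := max (b / 2) ((1 / 2 : ℝ) ^ m * a m)) fun n => ?_).trans_lt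
    (max_lt (by linarith) (h m))
  rcases le_total n N with hn | hn
  · exact (hm n (by simp; omega)).trans (le_max_right _ _)
  · exact ((dyadic_mul_le ha n).trans ((half_pow_anti hn).trans hN.le)).trans (le_max_left _ _)

lemma continuous_dyadicSup {X : Type*} [TopologicalSpace X] {a : ℕ → X → ℝ}
    (hc : ∀ n, Continuous (a n)) (ha : ∀ n x, a n x ∈ Icc (0 : ℝ) 1) :
    Continuous fun x => dyadicSup fun n => a n x := by
  refine continuous_iff_continuousAt.2 fun x => tendsto_order.2 ⟨fun b hb => ?_, fun b hb => ?_⟩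
  · obtain ⟨n, hn⟩ := exists_lt_of_lt_ciSup hb
    filter_upwards [((continuous_const.mul (hc n)).continuousAt (x := x)).eventually
      (lt_mem_nhds hn)] with y hy
    exact lt_of_lt_of_le hy (le_dyadicSup (fun n => ha n y) n)
  · have hb0 : 0 < b := (dyadicSup_nonneg fun n => ha n x).trans_lt hb
    obtain ⟨N, hN⟩ := exists_half_pow_lt hb0
    have hev : ∀ᶠ y in 𝓝 x, ∀ n ∈ Finset.range N, (1 / 2 : ℝ) ^ n * a n y < b := by
      refine (Filter.eventually_all_finset _).2 fun n _ => ?_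
      refine ((continuous_const.mul (hc n)).continuousAt (x := x)).eventually (gt_mem_nhds ?_)
      exact (le_dyadicSup (fun n => ha n x) n).trans_lt hb
    filter_upwards [hev] with y hy
    refine dyadicSup_lt (fun n => ha n y) hb0 fun n => ?_
    rcases lt_or_ge n N with hn | hn
    · exact hy n (by simpa using hn)
    · exact ((dyadic_mul_le (fun n => ha n y) n).trans (half_pow_anti hn)).trans_lt hN

end DyadicSup

/-- A continuous bounded weight on sequences, vanishing only at the zero sequence. -/
noncomputable def seqSize (v : ℕ → ℝ) : ℝ := dyadicSup fun j => |squash (v j)| / 4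

lemma abs_squash_div_four_mem (v : ℕ → ℝ) (j : ℕ) : |squash (v j)| / 4 ∈ Icc (0 : ℝ) 1 :=
  ⟨by positivity, by linarith [abs_squash_lt_one (v j)]⟩

lemma continuous_seqSize : Continuous seqSize := by
  refine continuous_dyadicSup (fun n => ?_) fun n v => abs_squash_div_four_mem v n
  exact ((continuous_squash.comp (continuous_apply n)).abs).div_const 4

lemma seqSize_nonneg (v : ℕ → ℝ) : 0 ≤ seqSize v := dyadicSup_nonneg (abs_squash_div_four_mem v)

lemma abs_squash_le_seqSize (v : ℕ → ℝ) (j : ℕ) :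
    |squash (v j)| ≤ 2 ^ (j + 2) * seqSize v := by
  have h := le_dyadicSup (abs_squash_div_four_mem v) j
  have h2 : (2 : ℝ) ^ (j + 2) * ((1 / 2) ^ j * (|squash (v j)| / 4)) = |squash (v j)| := by
    rw [pow_add, one_div, inv_pow]; field_simp; ring
  rw [← h2]
  exact mul_le_mul_of_nonneg_left h (by positivity)

lemma seqSize_lt {v : ℕ → ℝ} {t : ℝ} (ht : 0 < t)
    (h : ∀ j, |squash (v j)| < 2 ^ (j + 2) * t) : seqSize v < t := by
  refine dyadicSup_lt (abs_squash_div_four_mem v) ht fun j => ?_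
  have h2 : t = (1 / 2) ^ j * ((2 ^ (j + 2) * t) / 4) := by
    rw [pow_add, one_div, inv_pow]; field_simp; norm_num
  rw [h2]
  exact mul_lt_mul_of_pos_left (by linarith [h j]) (by positivity)

lemma seqSize_lt_quarter (v : ℕ → ℝ) : seqSize v < 1 / 4 := by
  refine seqSize_lt (by norm_num) fun j => (abs_squash_lt_one _).trans_le ?_
  rw [pow_add]
  have : (1 : ℝ) ≤ 2 ^ j := one_le_pow₀ (by norm_num)
  linarith

lemma seqSize_zero : seqSize 0 = 0 :=
  le_antisymm (dyadicSup_le fun n => by simp [squash_zero]) (seqSize_nonneg 0)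

lemma eq_zero_of_seqSize_eq_zero {v : ℕ → ℝ} (h : seqSize v = 0) : v = 0 := by
  ext j
  have h1 := abs_squash_le_seqSize v j
  rw [h, mul_zero] at h1
  have h2 : squash (v j) = 0 := abs_eq_zero.1 (le_antisymm h1 (abs_nonneg _))
  rw [← unsquash_squash (v j), h2, unsquash_zero, Pi.zero_apply]

/-- For `t > 0`, the width by which the `j`-th coordinate is compressed. -/
noncomputable def boxWidth (t : ℝ) (j : ℕ) : ℝ := min 1 (2 ^ (j + 2) * t)

lemma boxWidth_pos {t : ℝ} (ht : 0 < t) (j : ℕ) : 0 < boxWidth t j :=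
  lt_min one_pos (by positivity)

lemma boxWidth_zero (j : ℕ) : boxWidth 0 j = 0 := by simp [boxWidth]

lemma continuous_boxWidth (j : ℕ) : Continuous fun t => boxWidth t j := by
  unfold boxWidth; fun_prop

lemma abs_boxWidth_mul_lt_one {t : ℝ} (ht : 0 ≤ t) (j : ℕ) (x : ℝ) :
    |boxWidth t j * squash x| < 1 := by
  have h0 : 0 ≤ boxWidth t j := le_min zero_le_one (by positivity)
  rw [abs_mul, abs_of_nonneg h0]
  calc boxWidth t j * |squash x| ≤ 1 * |squash x| :=
        mul_le_mul_of_nonneg_right (min_le_left _ _) (abs_nonneg _)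
    _ < 1 := by rw [one_mul]; exact abs_squash_lt_one x

/-- For `t > 0`, a homeomorphism of the sequence space onto `{v | seqSize v < t}`. -/
noncomputable def compress (t : ℝ) (u : ℕ → ℝ) : ℕ → ℝ :=
  fun j => unsquash (boxWidth t j * squash (u j))

/-- The inverse of `compress t`. -/
noncomputable def decompress (t : ℝ) (v : ℕ → ℝ) : ℕ → ℝ :=
  fun j => unsquash (squash (v j) / boxWidth t j)

lemma decompress_compress {t : ℝ} (ht : 0 < t) (u : ℕ → ℝ) :
    decompress t (compress t u) = u := by
  ext j
  rw [decompress, compress, squash_unsquash (abs_boxWidth_mul_lt_one ht.le j _),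
    mul_div_cancel_left₀ _ (boxWidth_pos ht j).ne', unsquash_squash]

lemma abs_squash_div_boxWidth_lt_one {t : ℝ} {v : ℕ → ℝ} (hv : seqSize v < t) (j : ℕ) :
    |squash (v j) / boxWidth t j| < 1 := by
  have ht : 0 < t := (seqSize_nonneg v).trans_lt hv
  rw [abs_div, abs_of_pos (boxWidth_pos ht j), div_lt_one (boxWidth_pos ht j)]
  refine lt_min (abs_squash_lt_one _) ((abs_squash_le_seqSize v j).trans_lt ?_)
  exact mul_lt_mul_of_pos_left hv (by positivity)

lemma compress_decompress {t : ℝ} {v : ℕ → ℝ} (hv : seqSize v < t) :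
    compress t (decompress t v) = v := by
  have ht : 0 < t := (seqSize_nonneg v).trans_lt hv
  ext j
  rw [compress, decompress, squash_unsquash (abs_squash_div_boxWidth_lt_one hv j),
    mul_div_cancel₀ _ (boxWidth_pos ht j).ne', unsquash_squash]

lemma compress_zero (u : ℕ → ℝ) : compress 0 u = 0 := by
  ext j
  simp [compress, boxWidth_zero, unsquash_zero]

lemma seqSize_compress_lt {t : ℝ} (ht : 0 < t) (u : ℕ → ℝ) : seqSize (compress t u) < t := by
  refine seqSize_lt ht fun j => ?_
  rw [compress, squash_unsquash (abs_boxWidth_mul_lt_one ht.le j _), abs_mul,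
    abs_of_pos (boxWidth_pos ht j)]
  calc boxWidth t j * |squash (u j)| < boxWidth t j * 1 :=
        mul_lt_mul_of_pos_left (abs_squash_lt_one _) (boxWidth_pos ht j)
    _ ≤ 2 ^ (j + 2) * t := by rw [mul_one]; exact min_le_right _ _

/-- The fraction of a quarter turn performed at stage `k` at time `t`. -/
noncomputable def turn (k : ℕ) (t : ℝ) : ℝ := max 0 (min 1 (2 - 2 ^ k * t / 2))

/-- The sine of the angle of the `k`-th rotation at time `t`. -/
noncomputable def turnSin (k : ℕ) (t : ℝ) : ℝ := Real.sin (Real.pi / 2 * turn k t)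

/-- The cosine of the angle of the `k`-th rotation at time `t`. -/
noncomputable def turnCos (k : ℕ) (t : ℝ) : ℝ := Real.cos (Real.pi / 2 * turn k t)

lemma continuous_turnSin (k : ℕ) : Continuous (turnSin k) := by
  unfold turnSin turn; fun_prop

lemma continuous_turnCos (k : ℕ) : Continuous (turnCos k) := by
  unfold turnCos turn; fun_prop

lemma turn_sq_add_sq (k : ℕ) (t : ℝ) : turnSin k t ^ 2 + turnCos k t ^ 2 = 1 :=
  Real.sin_sq_add_cos_sq _

lemma turn_eq_one {k : ℕ} {t : ℝ} (h : 2 ^ k * t ≤ 2) : turn k t = 1 := by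
  rw [turn, min_eq_left (by linarith), max_eq_right zero_le_one]

lemma turn_eq_zero {k : ℕ} {t : ℝ} (h : 4 ≤ 2 ^ k * t) : turn k t = 0 := by
  rw [turn, max_eq_left]
  exact (min_le_right _ _).trans (by linarith)

lemma turnSin_of_le {k : ℕ} {t : ℝ} (h : 2 ^ k * t ≤ 2) : turnSin k t = 1 := by
  simp [turnSin, turn_eq_one h]

lemma turnCos_of_le {k : ℕ} {t : ℝ} (h : 2 ^ k * t ≤ 2) : turnCos k t = 0 := by
  simp [turnCos, turn_eq_one h]

lemma turnSin_of_ge {k : ℕ} {t : ℝ} (h : 4 ≤ 2 ^ k * t) : turnSin k t = 0 := by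
  simp [turnSin, turn_eq_zero h]

lemma turnCos_of_ge {k : ℕ} {t : ℝ} (h : 4 ≤ 2 ^ k * t) : turnCos k t = 1 := by
  simp [turnCos, turn_eq_zero h]

/-- The value carried into the `k`-th rotation when `u` is inserted into the sequence `e`. -/
noncomputable def carry (t u : ℝ) (e : ℕ → ℝ) : ℕ → ℝ
  | 0 => u
  | k + 1 => -turnSin k t * carry t u e k + turnCos k t * e k

/-- The sequence obtained by inserting `u` into the sequence `e` by successive rotations. -/
noncomputable def insertSeq (t u : ℝ) (e : ℕ → ℝ) (k : ℕ) : ℝ :=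
  turnCos k t * carry t u e k + turnSin k t * e k

/-- Recovery of the carried value at stage `k` from the output `o`, looking `n` stages ahead. -/
noncomputable def uncarryAux (t : ℝ) (o : ℕ → ℝ) : ℕ → ℕ → ℝ
  | 0, k => o k
  | n + 1, k => turnCos k t * o k - turnSin k t * uncarryAux t o n (k + 1)

/-- Recovery of the carried value at stage `k` from the output `o`, for `t > 0`. -/
noncomputable def uncarry (t : ℝ) (o : ℕ → ℝ) (k : ℕ) : ℝ := uncarryAux t o ⌈4 / t⌉₊ k

/-- The sequence into which a value was inserted to give `o`. -/
noncomputable def removeSeq (t : ℝ) (o : ℕ → ℝ) (k : ℕ) : ℝ :=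
  turnSin k t * o k + turnCos k t * uncarry t o (k + 1)

lemma insertSeq_of_le {k : ℕ} {t : ℝ} (h : 2 ^ k * t ≤ 2) (u : ℝ) (e : ℕ → ℝ) :
    insertSeq t u e k = e k := by
  simp [insertSeq, turnSin_of_le h, turnCos_of_le h]

lemma removeSeq_of_le {k : ℕ} {t : ℝ} (h : 2 ^ k * t ≤ 2) (o : ℕ → ℝ) :
    removeSeq t o k = o k := by
  simp [removeSeq, turnSin_of_le h, turnCos_of_le h]

lemma continuous_carry (k : ℕ) :
    Continuous fun q : ℝ × ℝ × (ℕ → ℝ) => carry q.1 q.2.1 q.2.2 k := by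
  induction k with
  | zero => exact continuous_snd.fst
  | succ k ih =>
    have h1 := (continuous_turnSin k).comp (continuous_fst (X := ℝ) (Y := ℝ × (ℕ → ℝ)))
    have h2 := (continuous_turnCos k).comp (continuous_fst (X := ℝ) (Y := ℝ × (ℕ → ℝ)))
    exact (h1.neg.mul ih).add (h2.mul (by fun_prop))

lemma continuous_insertSeq (k : ℕ) :
    Continuous fun q : ℝ × ℝ × (ℕ → ℝ) => insertSeq q.1 q.2.1 q.2.2 k := by
  have h1 := (continuous_turnSin k).comp (continuous_fst (X := ℝ) (Y := ℝ × (ℕ → ℝ)))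
  have h2 := (continuous_turnCos k).comp (continuous_fst (X := ℝ) (Y := ℝ × (ℕ → ℝ)))
  exact (h2.mul (continuous_carry k)).add (h1.mul (by fun_prop))

lemma continuous_uncarryAux (n : ℕ) : ∀ k : ℕ,
    Continuous fun q : ℝ × (ℕ → ℝ) => uncarryAux q.1 q.2 n k := by
  induction n with
  | zero => intro k; simp only [uncarryAux]; fun_prop
  | succ n ih =>
    intro k
    have h1 := (continuous_turnSin k).comp (continuous_fst (X := ℝ) (Y := ℕ → ℝ))
    have h2 := (continuous_turnCos k).comp (continuous_fst (X := ℝ) (Y := ℕ → ℝ))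
    exact (h2.mul (by fun_prop)).sub (h1.mul (ih (k + 1)))

lemma uncarryAux_succ_of_ge {t : ℝ} (o : ℕ → ℝ) (n : ℕ) : ∀ k : ℕ, 4 ≤ 2 ^ (k + n) * t →
    uncarryAux t o (n + 1) k = uncarryAux t o n k := by
  induction n with
  | zero =>
    intro k h
    simp [uncarryAux, turnSin_of_ge (k := k) h, turnCos_of_ge (k := k) h]
  | succ n ih =>
    intro k h
    rw [uncarryAux, ih (k + 1) (by rwa [Nat.add_right_comm]), uncarryAux]

lemma four_le_two_pow_mul {t s : ℝ} (hs : 0 < s) (hst : s ≤ t) {n : ℕ} (hn : ⌈4 / s⌉₊ ≤ n) :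
    4 ≤ 2 ^ n * t := by
  have h1 : 4 / s ≤ (n : ℝ) := (Nat.le_ceil _).trans (by exact_mod_cast hn)
  have h2 : (n : ℝ) ≤ 2 ^ n := by exact_mod_cast Nat.lt_two_pow_self.le
  calc (4 : ℝ) = 4 / s * s := by field_simp
    _ ≤ 2 ^ n * t := mul_le_mul (h1.trans h2) hst hs.le (by positivity)

lemma uncarryAux_eq_uncarry {t : ℝ} (ht : 0 < t) (o : ℕ → ℝ) (k : ℕ) {n : ℕ}
    (hn : ⌈4 / t⌉₊ ≤ n) : uncarryAux t o n k = uncarry t o k := by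
  induction n, hn using Nat.le_induction with
  | base => rfl
  | succ n hn ih =>
    rw [uncarryAux_succ_of_ge o n k (four_le_two_pow_mul ht le_rfl (by omega)), ih]

lemma uncarry_eq {t : ℝ} (ht : 0 < t) (o : ℕ → ℝ) (k : ℕ) :
    uncarry t o k = turnCos k t * o k - turnSin k t * uncarry t o (k + 1) := by
  rw [← uncarryAux_eq_uncarry ht o k (Nat.le_succ _), uncarryAux]
  rfl

lemma continuousAt_uncarry {q : ℝ × (ℕ → ℝ)} (hq : 0 < q.1) (k : ℕ) :
    ContinuousAt (fun q : ℝ × (ℕ → ℝ) => uncarry q.1 q.2 k) q := by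
  refine (continuous_uncarryAux ⌈4 / (q.1 / 2)⌉₊ k).continuousAt.congr ?_
  filter_upwards [continuousAt_fst.eventually (lt_mem_nhds (half_lt_self hq))] with p hp
  have hp' : q.1 / 2 < p.1 := hp
  refine uncarryAux_eq_uncarry ((half_pos hq).trans hp') p.2 k (Nat.ceil_mono ?_)
  exact div_le_div_of_nonneg_left (by norm_num) (half_pos hq) hp'.le

lemma continuous_removeSeq (k : ℕ) :
    Continuous fun q : ℝ × (ℕ → ℝ) => removeSeq q.1 q.2 k := by
  refine continuous_iff_continuousAt.2 fun q => ?_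
  rcases lt_or_ge 0 q.1 with hq | hq
  · have h1 := (continuous_turnSin k).comp (continuous_fst (X := ℝ) (Y := ℕ → ℝ))
    have h2 := (continuous_turnCos k).comp (continuous_fst (X := ℝ) (Y := ℕ → ℝ))
    exact (h1.mul (by fun_prop)).continuousAt.add
      (h2.continuousAt.mul (continuousAt_uncarry hq (k + 1)))
  · have h : Continuous fun p : ℝ × (ℕ → ℝ) => 2 ^ k * p.1 := by fun_prop
    have h0 : 2 ^ k * q.1 < 2 :=
      (mul_nonpos_of_nonneg_of_nonpos (by positivity) hq).trans_lt (by norm_num)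
    refine ((continuous_apply k).comp continuous_snd).continuousAt.congr ?_
    filter_upwards [h.continuousAt.eventually (gt_mem_nhds h0)] with p hp
    exact (removeSeq_of_le hp.le p.2).symm

lemma uncarry_insertSeq {t : ℝ} (ht : 0 < t) (u : ℝ) (e : ℕ → ℝ) (k : ℕ) :
    uncarry t (insertSeq t u e) k = carry t u e k := by
  have key : ∀ n k : ℕ, 4 ≤ 2 ^ (k + n) * t →
      uncarryAux t (insertSeq t u e) n k = carry t u e k := by
    intro n
    induction n with
    | zero =>
      intro k h
      simp [uncarryAux, insertSeq, turnSin_of_ge (k := k) h, turnCos_of_ge (k := k) h]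
    | succ n ih =>
      intro k h
      rw [uncarryAux, ih (k + 1) (by rwa [Nat.add_right_comm]), insertSeq, carry]
      linear_combination carry t u e k * turn_sq_add_sq k t
  exact key _ k (four_le_two_pow_mul ht le_rfl (by omega))

lemma removeSeq_insertSeq {t : ℝ} (ht : 0 ≤ t) (u : ℝ) (e : ℕ → ℝ) :
    removeSeq t (insertSeq t u e) = e := by
  ext k
  rcases ht.eq_or_lt with rfl | ht
  · rw [removeSeq_of_le (by simp), insertSeq_of_le (by simp)]
  · rw [removeSeq, uncarry_insertSeq ht, insertSeq, carry]
    linear_combination e k * turn_sq_add_sq k t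

lemma carry_removeSeq {t : ℝ} (ht : 0 < t) (o : ℕ → ℝ) (k : ℕ) :
    carry t (uncarry t o 0) (removeSeq t o) k = uncarry t o k := by
  induction k with
  | zero => rfl
  | succ k ih =>
    rw [carry, ih, removeSeq, uncarry_eq ht o k]
    linear_combination uncarry t o (k + 1) * turn_sq_add_sq k t

lemma insertSeq_removeSeq {t : ℝ} (ht : 0 < t) (o : ℕ → ℝ) :
    insertSeq t (uncarry t o 0) (removeSeq t o) = o := by
  ext k
  rw [insertSeq, carry_removeSeq ht, removeSeq, uncarry_eq ht o k]
  linear_combination o k * turn_sq_add_sq k t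

/-- The dilation factor at level `m`: it is `1` when `c` is small compared with `2⁻ᵐ` and it blows
up as `t` decreases to `c` otherwise. -/
noncomputable def stretch (m : ℕ) (c t : ℝ) : ℝ := 1 + max 0 (c - (1 / 2) ^ (m + 2)) / (t - c)

/-- The admissible pairs of a size `c` and a time `t`. -/
def Admissible (c t : ℝ) : Prop := 0 ≤ c ∧ c < 1 / 4 ∧ (c < t ∨ c = 0 ∧ t = 0)

namespace Admissible

variable {c t t' : ℝ}

lemma le (h : Admissible c t) : c ≤ t := by
  rcases h.2.2 with h | h
  · exact h.le
  · rw [h.1, h.2]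

lemma nonneg (h : Admissible c t) : 0 ≤ t := h.1.trans h.le

lemma mono (h : Admissible c t) (ht : t ≤ t') : Admissible c t' := by
  refine ⟨h.1, h.2.1, ?_⟩
  rcases ht.eq_or_lt with rfl | ht
  · exact h.2.2
  · exact Or.inl (h.le.trans_lt ht)

end Admissible

section Stretch

variable {m : ℕ} {c t t' : ℝ}

lemma stretch_zero_size (m : ℕ) (t : ℝ) : stretch m 0 t = 1 := by
  rw [stretch, max_eq_left, zero_div, add_zero]
  rw [zero_sub, neg_nonpos]
  positivity

lemma stretch_level_zero (h : Admissible c t) : stretch 0 c t = 1 := by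
  rw [stretch, max_eq_left, zero_div, add_zero]
  have := h.2.1
  norm_num
  linarith

lemma one_le_stretch (h : Admissible c t) : 1 ≤ stretch m c t := by
  have h1 : 0 ≤ max 0 (c - (1 / 2) ^ (m + 2)) / (t - c) :=
    div_nonneg (le_max_left _ _) (by linarith [h.le])
  rw [stretch]
  linarith

lemma stretch_pos (h : Admissible c t) : 0 < stretch m c t := one_pos.trans_le (one_le_stretch h)

lemma stretch_anti (h : Admissible c t) (ht : t ≤ t') : stretch m c t' ≤ stretch m c t := by
  rcases h.2.2 with h1 | h1
  · exact add_le_add le_rfl (div_le_div_of_nonneg_left (le_max_left _ _) (by linarith)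
      (by linarith))
  · rw [h1.1, stretch_zero_size, stretch_zero_size]

lemma continuousAt_stretch (m : ℕ) {q : ℝ × ℝ} (h : Admissible q.1 q.2) :
    ContinuousAt (fun q : ℝ × ℝ => stretch m q.1 q.2) q := by
  rcases h.2.2 with h1 | h1
  · unfold stretch
    exact continuousAt_const.add (ContinuousAt.div (by fun_prop) (by fun_prop) (by linarith))
  · refine continuousAt_const.congr (f := fun _ => (1 : ℝ)) ?_
    have h2 : q.1 < (1 / 2) ^ (m + 2) := by rw [h1.1]; positivity
    filter_upwards [continuousAt_fst.eventually (gt_mem_nhds h2)] with p hp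
    have hp' : p.1 < (1 / 2) ^ (m + 2) := hp
    rw [stretch, max_eq_left (by linarith), zero_div, add_zero]

lemma tendsto_inv_stretch (hm : (1 / 2) ^ (m + 2) < c) :
    Filter.Tendsto (fun t => (stretch m c t)⁻¹) (𝓝[>] c) (𝓝 0) := by
  have hw : 0 < max 0 (c - (1 / 2) ^ (m + 2)) := lt_max_of_lt_right (by linarith)
  have h1 : Filter.Tendsto (fun t => t - c) (𝓝[>] c) (𝓝[>] 0) := by
    refine tendsto_nhdsWithin_iff.2 ⟨?_, ?_⟩
    · have : ContinuousAt (fun t => t - c) c := by fun_prop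
      simpa using this.tendsto.mono_left (nhdsWithin_le_nhds (s := Ioi c))
    · filter_upwards [self_mem_nhdsWithin] with t ht
      exact mem_Ioi.2 (sub_pos.2 (mem_Ioi.1 ht))
  have h2 := (tendsto_inv_nhdsGT_zero.comp h1).const_mul_atTop hw
  exact (Filter.tendsto_atTop_add_const_left _ 1 h2).inv_tendsto_atTop

end Stretch

section Levels

variable {A : Type u}

/-- Scaling of each coordinate by a factor depending only on its level. -/
def scaleBy (lev : A → ℕ) (l : ℕ → ℝ) (p : A → ℝ) : A → ℝ := fun d => l (lev d) * p d

/-- A bounded continuous function on `ℝ^A` that does not decrease when the coordinates of positive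
level are contracted, is at least `2⁻ᵐ` when all the coordinates of level `m` vanish, and whose
values above `τ` depend only on the coordinates whose level `m` satisfies `τ < 2⁻ᵐ`. -/
structure IsGauge (lev : A → ℕ) (ω : (A → ℝ) → ℝ) : Prop where
  continuous : Continuous ω
  nonneg : ∀ p, 0 ≤ ω p
  le_one : ∀ p, ω p ≤ 1
  le_scaleBy : ∀ (l : ℕ → ℝ) (p : A → ℝ), l 0 = 1 → (∀ m, l m ∈ Icc (0 : ℝ) 1) →
    ω p ≤ ω (scaleBy lev l p)
  le_of_level_eq_zero : ∀ (p : A → ℝ) (m : ℕ), 1 ≤ m → (∀ d, lev d = m → p d = 0) →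
    (1 / 2) ^ m ≤ ω p
  eq_of_lt : ∀ (τ : ℝ) (p p' : A → ℝ), (∀ d, τ < (1 / 2) ^ lev d → p d = p' d) → τ < ω p →
    ω p' = ω p

/-- Contraction of the levels by the factors `stretch`. -/
noncomputable def shrink (lev : A → ℕ) (c t : ℝ) (p : A → ℝ) : A → ℝ :=
  scaleBy lev (fun m => (stretch m c t)⁻¹) p

/-- Dilation of the levels by the factors `stretch`. -/
noncomputable def dilate (lev : A → ℕ) (c t : ℝ) (p : A → ℝ) : A → ℝ :=
  scaleBy lev (fun m => stretch m c t) p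

variable {lev : A → ℕ} {ω : (A → ℝ) → ℝ} {c t t' : ℝ}

lemma shrink_dilate (h : Admissible c t) (p : A → ℝ) : shrink lev c t (dilate lev c t p) = p := by
  ext d
  exact inv_mul_cancel_left₀ (stretch_pos h).ne' _

lemma dilate_shrink (h : Admissible c t) (p : A → ℝ) : dilate lev c t (shrink lev c t p) = p := by
  ext d
  exact mul_inv_cancel_left₀ (stretch_pos h).ne' _

lemma shrink_zero_size (t : ℝ) (p : A → ℝ) : shrink lev 0 t p = p := by
  ext d
  simp [shrink, scaleBy, stretch_zero_size]

lemma dilate_zero_size (t : ℝ) (p : A → ℝ) : dilate lev 0 t p = p := by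
  ext d
  simp [dilate, scaleBy, stretch_zero_size]

lemma dilate_of_level_zero (h : Admissible c t) (p : A → ℝ) {d : A} (hd : lev d = 0) :
    dilate lev c t p d = p d := by
  simp [dilate, scaleBy, hd, stretch_level_zero h]

lemma continuousAt_dilate {q : ℝ × ℝ × (A → ℝ)} (h : Admissible q.1 q.2.1) :
    ContinuousAt (fun q : ℝ × ℝ × (A → ℝ) => dilate lev q.1 q.2.1 q.2.2) q := by
  refine continuousAt_pi.2 fun d => ContinuousAt.mul ?_ (by fun_prop)
  exact ContinuousAt.comp (f := fun q : ℝ × ℝ × (A → ℝ) => (q.1, q.2.1))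
    (continuousAt_stretch (lev d) h) (by fun_prop)

lemma continuous_dilate {X : Type*} [TopologicalSpace X] {c t : X → ℝ} {x : X → A → ℝ}
    (hc : Continuous c) (ht : Continuous t) (hx : Continuous x)
    (h : ∀ y, Admissible (c y) (t y)) : Continuous fun y => dilate lev (c y) (t y) (x y) := by
  refine continuous_iff_continuousAt.2 fun y => ?_
  exact ContinuousAt.comp (f := fun y => (c y, t y, x y))
    (continuousAt_dilate (lev := lev) (q := (c y, t y, x y)) (h y))
    (hc.prodMk (ht.prodMk hx)).continuousAt

lemma continuousAt_shrink {q : ℝ × ℝ × (A → ℝ)} (h : Admissible q.1 q.2.1) :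
    ContinuousAt (fun q : ℝ × ℝ × (A → ℝ) => shrink lev q.1 q.2.1 q.2.2) q := by
  refine continuousAt_pi.2 fun d => ContinuousAt.mul ?_ (by fun_prop)
  refine ContinuousAt.inv₀ ?_ (stretch_pos h).ne'
  exact ContinuousAt.comp (f := fun q : ℝ × ℝ × (A → ℝ) => (q.1, q.2.1))
    (continuousAt_stretch (lev d) h) (by fun_prop)

lemma IsGauge.shrink_anti (hω : IsGauge lev ω) (h : Admissible c t) (ht : t ≤ t') (p : A → ℝ) :
    ω (shrink lev c t' p) ≤ ω (shrink lev c t p) := by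
  have h' := h.mono ht
  have key : shrink lev c t p =
      scaleBy lev (fun m => stretch m c t' / stretch m c t) (shrink lev c t' p) := by
    ext d
    have h1 := (stretch_pos (m := lev d) h).ne'
    have h2 := (stretch_pos (m := lev d) h').ne'
    simp only [shrink, scaleBy]
    field_simp
  rw [key]
  refine hω.le_scaleBy _ _ ?_ fun m => ⟨?_, ?_⟩
  · simp [stretch_level_zero h, stretch_level_zero h']
  · exact div_nonneg (stretch_pos h').le (stretch_pos h).le
  · exact div_le_one_of_le₀ (stretch_anti h ht) (stretch_pos h).le

/-- The time `t` matches `p` and a size `c`. -/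
def IsMatch (lev : A → ℕ) (ω : (A → ℝ) → ℝ) (c : ℝ) (p : A → ℝ) (t : ℝ) : Prop :=
  Admissible c t ∧ ω (shrink lev c t p) = t

lemma IsMatch.unique (hω : IsGauge lev ω) {p : A → ℝ} (h : IsMatch lev ω c p t)
    (h' : IsMatch lev ω c p t') : t = t' := by
  wlog htt : t ≤ t' generalizing t t'
  · exact (this h' h (le_of_not_ge htt)).symm
  have hle := hω.shrink_anti h.1 htt p
  rw [h.2, h'.2] at hle
  exact le_antisymm htt hle

lemma IsGauge.exists_isMatch (hω : IsGauge lev ω) (hc : 0 ≤ c) (hc' : c < 1 / 4) (p : A → ℝ) :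
    ∃ t, IsMatch lev ω c p t := by
  rcases hc.eq_or_lt with rfl | hc0
  · refine ⟨ω p, ⟨le_rfl, by norm_num, ?_⟩, by rw [shrink_zero_size]⟩
    rcases (hω.nonneg p).eq_or_lt with h | h
    · exact Or.inr ⟨rfl, h.symm⟩
    · exact Or.inl h
  obtain ⟨n, hn1, hn2⟩ := exists_nat_pow_near_of_lt_one (x := 4 * c) (y := (1 / 2 : ℝ))
    (by linarith) (by linarith) (by norm_num) (by norm_num)
  have hcm : c < (1 / 2) ^ (n + 1) := by rw [pow_succ]; linarith
  have hmc : (1 / 2) ^ (n + 1 + 2) < c := by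
    rw [pow_add _ (n + 1)]; linarith
  have hlim : Filter.Tendsto (fun t => shrink lev c t p) (𝓝[>] c)
      (𝓝 fun d => if (1 / 2) ^ (lev d + 2) < c then 0 else p d) := by
    refine tendsto_pi_nhds.2 fun d => ?_
    by_cases hd : (1 / 2) ^ (lev d + 2) < c
    · simp only [hd, if_true]
      simpa only [shrink, scaleBy, zero_mul] using (tendsto_inv_stretch hd).mul_const (p d)
    · have h0 : max 0 (c - (1 / 2) ^ (lev d + 2)) = 0 := max_eq_left (by linarith)
      simp only [shrink, scaleBy, stretch, h0, hd, if_false, zero_div, add_zero, inv_one, one_mul]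
      exact tendsto_const_nhds
  have hgt : c < ω fun d => if (1 / 2) ^ (lev d + 2) < c then 0 else p d := by
    refine hcm.trans_le (hω.le_of_level_eq_zero _ _ (by omega) fun d hd => ?_)
    rw [hd, if_pos hmc]
  have hev : ∀ᶠ t in 𝓝[>] c, t < ω (shrink lev c t p) :=
    (Filter.tendsto_id.mono_left nhdsWithin_le_nhds).eventually_lt
      ((hω.continuous.tendsto _).comp hlim) hgt
  obtain ⟨t₁, ⟨ht₁, hc₁⟩, ht₁'⟩ :=
    ((hev.and self_mem_nhdsWithin).and (Ioo_mem_nhdsGT (show c < 1 by linarith))).exists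
  have hadm : ∀ t ∈ Icc t₁ 1, Admissible c t := fun t ht =>
    ⟨hc, hc', Or.inl (lt_of_lt_of_le hc₁ ht.1)⟩
  have hcont : ContinuousOn (fun t => ω (shrink lev c t p) - t) (Icc t₁ 1) := by
    intro t ht
    refine ContinuousAt.continuousWithinAt (ContinuousAt.sub ?_ continuousAt_id)
    refine hω.continuous.continuousAt.comp ?_
    exact ContinuousAt.comp (f := fun t : ℝ => (c, t, p))
      (continuousAt_shrink (lev := lev) (q := (c, t, p)) (hadm t ht)) (by fun_prop)
  obtain ⟨t, ht, h0⟩ := intermediate_value_Icc' ht₁'.2.le hcont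
    (show (0 : ℝ) ∈ _ from ⟨by linarith [hω.le_one (shrink lev c 1 p)], by linarith⟩)
  exact ⟨t, hadm t ht, by linarith [h0]⟩

/-- The time matching `p` and the size of `v`. -/
noncomputable def matchTime (lev : A → ℕ) (ω : (A → ℝ) → ℝ) (q : (ℕ → ℝ) × (A → ℝ)) : ℝ :=
  Classical.epsilon (IsMatch lev ω (seqSize q.1) q.2)

lemma IsGauge.isMatch_matchTime (hω : IsGauge lev ω) (q : (ℕ → ℝ) × (A → ℝ)) :
    IsMatch lev ω (seqSize q.1) q.2 (matchTime lev ω q) :=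
  Classical.epsilon_spec (hω.exists_isMatch (seqSize_nonneg _) (seqSize_lt_quarter _) _)

lemma IsGauge.continuous_matchTime (hω : IsGauge lev ω) : Continuous (matchTime lev ω) := by
  have hR : ∀ (s : ℝ) (q : (ℕ → ℝ) × (A → ℝ)), Admissible (seqSize q.1) s →
      ContinuousAt (fun q : (ℕ → ℝ) × (A → ℝ) => ω (shrink lev (seqSize q.1) s q.2)) q := by
    intro s q hq
    have hf : Continuous fun q : (ℕ → ℝ) × (A → ℝ) => (seqSize q.1, s, q.2) :=
      (continuous_seqSize.comp continuous_fst).prodMk (by fun_prop)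
    refine hω.continuous.continuousAt.comp ?_
    exact ContinuousAt.comp (f := fun q : (ℕ → ℝ) × (A → ℝ) => (seqSize q.1, s, q.2))
      (continuousAt_shrink (lev := lev) (q := (seqSize q.1, s, q.2)) hq) hf.continuousAt
  have hsize : Continuous fun q : (ℕ → ℝ) × (A → ℝ) => seqSize q.1 :=
    continuous_seqSize.comp continuous_fst
  refine continuous_iff_continuousAt.2 fun q => tendsto_order.2 ⟨fun b hb => ?_, fun b hb => ?_⟩
  · obtain ⟨hadm, heq⟩ := hω.isMatch_matchTime q
    rcases hadm.2.2 with hlt | h0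
    · obtain ⟨s, hs, hst⟩ := exists_between (max_lt hb hlt)
      have hbs := (le_max_left _ _).trans_lt hs
      have hcs := (le_max_right _ _).trans_lt hs
      have hs' : Admissible (seqSize q.1) s := ⟨hadm.1, hadm.2.1, Or.inl hcs⟩
      have hRs : s < ω (shrink lev (seqSize q.1) s q.2) := by
        have := hω.shrink_anti hs' hst.le q.2
        linarith
      filter_upwards [(hR s q hs').eventually (lt_mem_nhds hRs)] with r hr
      obtain ⟨hadm', heq'⟩ := hω.isMatch_matchTime r
      by_contra! hle
      have := hω.shrink_anti hadm' (hle.trans hbs.le) r.2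
      linarith
    · refine Filter.Eventually.of_forall fun r => ?_
      rw [h0.2] at hb
      exact hb.trans_le (hω.isMatch_matchTime r).1.nonneg
  · obtain ⟨hadm, heq⟩ := hω.isMatch_matchTime q
    have hb' := hadm.mono hb.le
    have hRb : ω (shrink lev (seqSize q.1) b q.2) < b := by
      have := hω.shrink_anti hadm hb.le q.2
      linarith
    filter_upwards [(hR b q hb').eventually (gt_mem_nhds hRb),
      hsize.continuousAt.eventually (gt_mem_nhds (hadm.le.trans_lt hb))] with r hr hr'
    obtain ⟨hadm', heq'⟩ := hω.isMatch_matchTime r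
    by_contra! hle
    have := hω.shrink_anti (t := b) ⟨seqSize_nonneg _, seqSize_lt_quarter _, Or.inl hr'⟩ hle r.2
    linarith

end Levels

section Absorption

variable {A : Type u} {lev : A → ℕ} {ω : (A → ℝ) → ℝ} {e : ℕ × ℕ → A}

/-- Simultaneous insertion of the values `u j` into the sequences `k ↦ p (e (k, j))`. -/
noncomputable def insertAt (e : ℕ × ℕ → A) (t : ℝ) (u : ℕ → ℝ) (p : A → ℝ) : A → ℝ :=
  Function.extend e (fun x => insertSeq t (u x.2) (fun k => p (e (k, x.2))) x.1) p

/-- Removal of the values inserted by `insertAt`. -/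
noncomputable def removeAt (e : ℕ × ℕ → A) (t : ℝ) (p : A → ℝ) : A → ℝ :=
  Function.extend e (fun x => removeSeq t (fun k => p (e (k, x.2))) x.1) p

/-- The values inserted by `insertAt`. -/
noncomputable def extractAt (e : ℕ × ℕ → A) (t : ℝ) (p : A → ℝ) : ℕ → ℝ :=
  fun j => uncarry t (fun k => p (e (k, j))) 0

lemma insertAt_apply (he : Function.Injective e) (t : ℝ) (u : ℕ → ℝ) (p : A → ℝ) (x : ℕ × ℕ) :
    insertAt e t u p (e x) = insertSeq t (u x.2) (fun k => p (e (k, x.2))) x.1 :=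
  he.extend_apply _ _ _

lemma removeAt_apply (he : Function.Injective e) (t : ℝ) (p : A → ℝ) (x : ℕ × ℕ) :
    removeAt e t p (e x) = removeSeq t (fun k => p (e (k, x.2))) x.1 :=
  he.extend_apply _ _ _

lemma insertAt_of_notMem {d : A} (hd : ¬∃ x, e x = d) (t : ℝ) (u : ℕ → ℝ) (p : A → ℝ) :
    insertAt e t u p d = p d :=
  Function.extend_apply' _ _ _ hd

lemma removeAt_of_notMem {d : A} (hd : ¬∃ x, e x = d) (t : ℝ) (p : A → ℝ) :
    removeAt e t p d = p d :=
  Function.extend_apply' _ _ _ hd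

lemma insertAt_zero (he : Function.Injective e) (u : ℕ → ℝ) (p : A → ℝ) :
    insertAt e 0 u p = p := by
  ext d
  by_cases hd : ∃ x, e x = d
  · obtain ⟨x, rfl⟩ := hd
    rw [insertAt_apply he, insertSeq_of_le (by simp)]
  · exact insertAt_of_notMem hd _ _ _

lemma removeAt_zero (he : Function.Injective e) (p : A → ℝ) : removeAt e 0 p = p := by
  ext d
  by_cases hd : ∃ x, e x = d
  · obtain ⟨x, rfl⟩ := hd
    rw [removeAt_apply he, removeSeq_of_le (by simp)]
  · exact removeAt_of_notMem hd _ _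

lemma removeAt_insertAt (he : Function.Injective e) {t : ℝ} (ht : 0 ≤ t) (u : ℕ → ℝ) (p : A → ℝ) :
    removeAt e t (insertAt e t u p) = p := by
  ext d
  by_cases hd : ∃ x, e x = d
  · obtain ⟨⟨k, j⟩, rfl⟩ := hd
    simp only [removeAt_apply he, insertAt_apply he]
    exact congrFun (removeSeq_insertSeq ht (u j) fun k => p (e (k, j))) k
  · rw [removeAt_of_notMem hd, insertAt_of_notMem hd]

lemma extractAt_insertAt (he : Function.Injective e) {t : ℝ} (ht : 0 < t) (u : ℕ → ℝ)
    (p : A → ℝ) : extractAt e t (insertAt e t u p) = u := by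
  ext j
  simp only [extractAt, insertAt_apply he]
  exact uncarry_insertSeq ht (u j) (fun k => p (e (k, j))) 0

lemma insertAt_removeAt (he : Function.Injective e) {t : ℝ} (ht : 0 < t) (p : A → ℝ) :
    insertAt e t (extractAt e t p) (removeAt e t p) = p := by
  ext d
  by_cases hd : ∃ x, e x = d
  · obtain ⟨⟨k, j⟩, rfl⟩ := hd
    simp only [removeAt_apply he, insertAt_apply he, extractAt]
    exact congrFun (insertSeq_removeSeq ht fun k => p (e (k, j))) k
  · rw [insertAt_of_notMem hd, removeAt_of_notMem hd]

lemma continuous_removeAt (he : Function.Injective e) :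
    Continuous fun q : ℝ × (A → ℝ) => removeAt e q.1 q.2 := by
  refine continuous_pi fun d => ?_
  by_cases hd : ∃ x, e x = d
  · obtain ⟨x, rfl⟩ := hd
    simp only [removeAt_apply he]
    exact (continuous_removeSeq x.1).comp
      (f := fun q : ℝ × (A → ℝ) => (q.1, fun k => q.2 (e (k, x.2)))) (by fun_prop)
  · simp only [removeAt_of_notMem hd]
    fun_prop

lemma continuousAt_extractAt {q : ℝ × (A → ℝ)} (hq : 0 < q.1) :
    ContinuousAt (fun q : ℝ × (A → ℝ) => extractAt e q.1 q.2) q := by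
  refine continuousAt_pi.2 fun j => ?_
  exact ContinuousAt.comp (f := fun q : ℝ × (A → ℝ) => (q.1, fun k => q.2 (e (k, j))))
    (continuousAt_uncarry (q := (q.1, fun k => q.2 (e (k, j)))) hq 0) (by fun_prop)

lemma continuous_insertAt (he : Function.Injective e) :
    Continuous fun q : ℝ × (ℕ → ℝ) × (A → ℝ) => insertAt e q.1 q.2.1 q.2.2 := by
  refine continuous_pi fun d => ?_
  by_cases hd : ∃ x, e x = d
  · obtain ⟨x, rfl⟩ := hd
    simp only [insertAt_apply he]
    exact (continuous_insertSeq x.1).comp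
      (f := fun q : ℝ × (ℕ → ℝ) × (A → ℝ) => (q.1, q.2.1 x.2, fun k => q.2.2 (e (k, x.2))))
      (by fun_prop)
  · simp only [insertAt_of_notMem hd]
    fun_prop

lemma insertAt_of_le (he : Function.Injective e) {t : ℝ} {x : ℕ × ℕ} (h : 2 ^ x.1 * t ≤ 2)
    (u : ℕ → ℝ) (p : A → ℝ) : insertAt e t u p (e x) = p (e x) := by
  rw [insertAt_apply he, insertSeq_of_le h]

/-- Inserting values at time `t` does not affect whether the gauge equals `t`. -/
lemma IsGauge.insertAt_eq (hω : IsGauge lev ω) (he : Function.Injective e)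
    (hlev : ∀ x, x.1 ≤ lev (e x)) {t : ℝ} (ht : 0 < t) (u : ℕ → ℝ) (p : A → ℝ) :
    ω (insertAt e t u p) = t ↔ ω p = t := by
  have hagree : ∀ d, t / 2 < (1 / 2) ^ lev d → insertAt e t u p d = p d := by
    intro d hd
    by_cases hx : ∃ x, e x = d
    · obtain ⟨x, rfl⟩ := hx
      refine insertAt_of_le he ?_ u p
      have h1 : t / 2 < (1 / 2) ^ x.1 := hd.trans_le (half_pow_anti (hlev x))
      have h2 : (2 : ℝ) ^ x.1 * (1 / 2) ^ x.1 = 1 := by rw [← mul_pow]; norm_num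
      have h3 := mul_lt_mul_of_pos_left h1 (show (0 : ℝ) < 2 ^ x.1 by positivity)
      linarith
    · exact insertAt_of_notMem hx _ _ _
  constructor
  · intro h
    rw [hω.eq_of_lt (t / 2) _ p hagree (by linarith), h]
  · intro h
    rw [hω.eq_of_lt (t / 2) p _ (fun d hd => (hagree d hd).symm) (by linarith), h]

/-- The map splitting off an extra sequence of coordinates away from the zero set of `ω`. -/
noncomputable def splitOff (lev : A → ℕ) (ω : (A → ℝ) → ℝ) (e : ℕ × ℕ → A) (p : A → ℝ) :
    (ℕ → ℝ) × (A → ℝ) :=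
  (compress (ω p) (extractAt e (ω p) p),
    dilate lev (seqSize (compress (ω p) (extractAt e (ω p) p))) (ω p) (removeAt e (ω p) p))

/-- The inverse of `splitOff`. -/
noncomputable def absorb (lev : A → ℕ) (ω : (A → ℝ) → ℝ) (e : ℕ × ℕ → A)
    (q : (ℕ → ℝ) × (A → ℝ)) : A → ℝ :=
  insertAt e (matchTime lev ω q) (decompress (matchTime lev ω q) q.1)
    (shrink lev (seqSize q.1) (matchTime lev ω q) q.2)

lemma admissible_compress {t : ℝ} (ht : 0 ≤ t) (u : ℕ → ℝ) :
    Admissible (seqSize (compress t u)) t := by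
  refine ⟨seqSize_nonneg _, seqSize_lt_quarter _, ?_⟩
  rcases ht.eq_or_lt with rfl | ht
  · exact Or.inr ⟨by rw [compress_zero, seqSize_zero], rfl⟩
  · exact Or.inl (seqSize_compress_lt ht u)

lemma splitOff_of_eq_zero (he : Function.Injective e) {p : A → ℝ} (hp : ω p = 0) :
    splitOff lev ω e p = (0, p) := by
  rw [splitOff, hp, compress_zero, seqSize_zero, removeAt_zero he, dilate_zero_size]

lemma IsGauge.matchTime_splitOff (hω : IsGauge lev ω) (he : Function.Injective e)
    (hlev : ∀ x, x.1 ≤ lev (e x)) (p : A → ℝ) : matchTime lev ω (splitOff lev ω e p) = ω p := by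
  refine (hω.isMatch_matchTime _).unique hω ⟨admissible_compress (hω.nonneg p) _, ?_⟩
  rw [splitOff, shrink_dilate (admissible_compress (hω.nonneg p) _)]
  rcases (hω.nonneg p).eq_or_lt with h | h
  · rw [← h, removeAt_zero he, ← h]
  · rw [← hω.insertAt_eq he hlev h (extractAt e (ω p) p), insertAt_removeAt he h]

lemma IsGauge.absorb_splitOff (hω : IsGauge lev ω) (he : Function.Injective e)
    (hlev : ∀ x, x.1 ≤ lev (e x)) (p : A → ℝ) : absorb lev ω e (splitOff lev ω e p) = p := by
  rw [absorb, hω.matchTime_splitOff he hlev, splitOff,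
    shrink_dilate (admissible_compress (hω.nonneg p) _)]
  rcases (hω.nonneg p).eq_or_lt with h | h
  · rw [← h, removeAt_zero he, insertAt_zero he]
  · rw [decompress_compress h, insertAt_removeAt he h]

lemma IsGauge.gauge_absorb (hω : IsGauge lev ω) (he : Function.Injective e)
    (hlev : ∀ x, x.1 ≤ lev (e x)) (q : (ℕ → ℝ) × (A → ℝ)) :
    ω (absorb lev ω e q) = matchTime lev ω q := by
  obtain ⟨hadm, heq⟩ := hω.isMatch_matchTime q
  rw [absorb]
  rcases hadm.nonneg.eq_or_lt with h | h
  · rw [← h] at heq ⊢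
    rw [insertAt_zero he, heq]
  · rw [hω.insertAt_eq he hlev h, heq]

lemma IsGauge.splitOff_absorb (hω : IsGauge lev ω) (he : Function.Injective e)
    (hlev : ∀ x, x.1 ≤ lev (e x)) (q : (ℕ → ℝ) × (A → ℝ)) :
    splitOff lev ω e (absorb lev ω e q) = q := by
  obtain ⟨hadm, -⟩ := hω.isMatch_matchTime q
  rw [splitOff, hω.gauge_absorb he hlev, absorb, removeAt_insertAt he hadm.nonneg]
  have hv : compress (matchTime lev ω q) (extractAt e (matchTime lev ω q)
      (insertAt e (matchTime lev ω q) (decompress (matchTime lev ω q) q.1)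
        (shrink lev (seqSize q.1) (matchTime lev ω q) q.2))) = q.1 := by
    rcases hadm.2.2 with h | h
    · rw [extractAt_insertAt he ((seqSize_nonneg _).trans_lt h), compress_decompress h]
    · rw [h.2, compress_zero, eq_zero_of_seqSize_eq_zero h.1]
  rw [hv, dilate_shrink hadm]

lemma IsGauge.continuous_splitOff (hω : IsGauge lev ω) (he : Function.Injective e) :
    Continuous (splitOff lev ω e) := by
  have hv : Continuous fun p => compress (ω p) (extractAt e (ω p) p) := by
    refine continuous_pi fun j => continuous_iff_continuousAt.2 fun p => ?_
    refine ContinuousAt.comp (g := unsquash)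
      (f := fun p => boxWidth (ω p) j * squash (extractAt e (ω p) p j))
      (continuousAt_unsquash (abs_boxWidth_mul_lt_one (hω.nonneg p) j _)) ?_
    have hbox : Continuous fun p => boxWidth (ω p) j :=
      (continuous_boxWidth j).comp hω.continuous
    rcases (hω.nonneg p).eq_or_lt with h | h
    · have h0 : Filter.Tendsto (fun p => boxWidth (ω p) j) (𝓝 p) (𝓝 0) := by
        simpa [← h, boxWidth_zero] using hbox.tendsto p
      have hb : Filter.IsBoundedUnder (· ≤ ·) (𝓝 p)
          (norm ∘ fun p => squash (extractAt e (ω p) p j)) :=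
        Filter.isBoundedUnder_of ⟨1, fun p => (abs_squash_lt_one _).le⟩
      rw [ContinuousAt, ← h, boxWidth_zero, zero_mul]
      exact h0.zero_mul_isBoundedUnder_le hb
    · have hx : ContinuousAt (fun p => extractAt e (ω p) p) p :=
        ContinuousAt.comp (f := fun p => (ω p, p))
          (continuousAt_extractAt (e := e) (q := (ω p, p)) h)
          (hω.continuous.prodMk continuous_id).continuousAt
      exact hbox.continuousAt.mul (continuous_squash.continuousAt.comp (continuousAt_pi.1 hx j))
  have hr : Continuous fun p => removeAt e (ω p) p :=
    Continuous.comp (f := fun p => (ω p, p)) (continuous_removeAt he)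
      (hω.continuous.prodMk continuous_id)
  have hadm : ∀ p, Admissible (seqSize (compress (ω p) (extractAt e (ω p) p))) (ω p) :=
    fun p => admissible_compress (hω.nonneg p) _
  exact hv.prodMk (continuous_dilate (continuous_seqSize.comp' hv) hω.continuous hr hadm)

lemma continuousAt_decompress {q : ℝ × (ℕ → ℝ)} (hq : seqSize q.2 < q.1) :
    ContinuousAt (fun q : ℝ × (ℕ → ℝ) => decompress q.1 q.2) q := by
  refine continuousAt_pi.2 fun j => ?_
  refine ContinuousAt.comp (g := unsquash) (f := fun q : ℝ × (ℕ → ℝ) =>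
    squash (q.2 j) / boxWidth q.1 j)
    (continuousAt_unsquash (abs_squash_div_boxWidth_lt_one hq j)) ?_
  refine ContinuousAt.div ?_ ?_ (boxWidth_pos ((seqSize_nonneg _).trans_lt hq) j).ne'
  · exact (continuous_squash.comp (by fun_prop)).continuousAt
  · exact ((continuous_boxWidth j).comp continuous_fst).continuousAt

lemma IsGauge.continuous_absorb (hω : IsGauge lev ω) (he : Function.Injective e) :
    Continuous (absorb lev ω e) := by
  have hT := hω.continuous_matchTime
  have hs : Continuous fun q : (ℕ → ℝ) × (A → ℝ) =>
      shrink lev (seqSize q.1) (matchTime lev ω q) q.2 := by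
    refine continuous_iff_continuousAt.2 fun q => ?_
    exact ContinuousAt.comp (f := fun q : (ℕ → ℝ) × (A → ℝ) =>
      (seqSize q.1, matchTime lev ω q, q.2)) (continuousAt_shrink (hω.isMatch_matchTime q).1)
      ((continuous_seqSize.comp continuous_fst).prodMk
        (hT.prodMk continuous_snd)).continuousAt
  refine continuous_iff_continuousAt.2 fun q => ?_
  rcases (hω.isMatch_matchTime q).1.2.2 with h | h
  · refine ContinuousAt.comp (f := fun q : (ℕ → ℝ) × (A → ℝ) => (matchTime lev ω q,
      decompress (matchTime lev ω q) q.1, shrink lev (seqSize q.1) (matchTime lev ω q) q.2))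
      (continuous_insertAt he).continuousAt ?_
    refine hT.continuousAt.prodMk (ContinuousAt.prodMk ?_ hs.continuousAt)
    exact ContinuousAt.comp (f := fun q : (ℕ → ℝ) × (A → ℝ) => (matchTime lev ω q, q.1))
      (continuousAt_decompress (q := (matchTime lev ω q, q.1)) h)
      (hT.prodMk continuous_fst).continuousAt
  · refine continuousAt_pi.2 fun d => ?_
    refine ((continuous_apply d).comp hs).continuousAt.congr ?_
    by_cases hd : ∃ x, e x = d
    · obtain ⟨x, rfl⟩ := hd
      have h2 : 2 ^ x.1 * matchTime lev ω q < 2 := by rw [h.2]; norm_num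
      filter_upwards [(continuous_const.mul hT).continuousAt.eventually (gt_mem_nhds h2)] with r hr
      exact (insertAt_of_le he hr.le _ _).symm
    · exact Filter.Eventually.of_forall fun r => (insertAt_of_notMem hd _ _ _).symm

/-- A homeomorphism `ℝ^A ≃ ℝ^ℕ × ℝ^A` which is `p ↦ (0, p)` on the zero set of the gauge `ω`. -/
noncomputable def IsGauge.splitOffHomeomorph (hω : IsGauge lev ω) (he : Function.Injective e)
    (hlev : ∀ x, x.1 ≤ lev (e x)) : (A → ℝ) ≃ₜ (ℕ → ℝ) × (A → ℝ) where
  toFun := splitOff lev ω e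
  invFun := absorb lev ω e
  left_inv := hω.absorb_splitOff he hlev
  right_inv := hω.splitOff_absorb he hlev
  continuous_toFun := hω.continuous_splitOff he
  continuous_invFun := hω.continuous_absorb he

lemma IsGauge.splitOff_of_level_zero (hω : IsGauge lev ω) (hpos : ∀ x, lev (e x) ≠ 0)
    (p : A → ℝ) {d : A} (hd : lev d = 0) : (splitOff lev ω e p).2 d = p d := by
  have hx : ¬∃ x, e x = d := by
    rintro ⟨x, rfl⟩
    exact hpos x hd
  simp only [splitOff]
  rw [dilate_of_level_zero (admissible_compress (hω.nonneg p) _) _ hd, removeAt_of_notMem hx]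

end Absorption

section Gauge

variable {A : Type u} {lev : A → ℕ}

/-- The scaling factors which are admissible in `IsGauge.le_scaleBy`. -/
def contractions : Set (ℕ → ℝ) := Set.pi univ (fun _ => Icc (0 : ℝ) 1) ∩ {l | l 0 = 1}

lemma isCompact_contractions : IsCompact contractions :=
  (isCompact_univ_pi fun _ => isCompact_Icc).inter_right
    (isClosed_eq (continuous_apply 0) continuous_const)

lemma one_mem_contractions : (fun _ => 1 : ℕ → ℝ) ∈ contractions :=
  ⟨fun _ _ => ⟨zero_le_one, le_rfl⟩, rfl⟩

lemma scaleBy_scaleBy (l l' : ℕ → ℝ) (p : A → ℝ) :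
    scaleBy lev l' (scaleBy lev l p) = scaleBy lev (fun m => l' m * l m) p := by
  ext d
  simp only [scaleBy, mul_assoc]

lemma continuous_scaleBy : Continuous fun x : (A → ℝ) × (ℕ → ℝ) => scaleBy lev x.2 x.1 := by
  unfold scaleBy
  fun_prop

/-- The smallest value of `η` on the contractions of `p`. -/
noncomputable def contractedInf (lev : A → ℕ) (η : (A → ℝ) → ℝ) (p : A → ℝ) : ℝ :=
  sInf ((fun l => η (scaleBy lev l p)) '' contractions)

section ContractedInf

variable {η : (A → ℝ) → ℝ}

lemma continuous_contractedInf (hη : Continuous η) : Continuous (contractedInf lev η) :=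
  isCompact_contractions.continuous_sInf (f := fun p l => η (scaleBy lev l p))
    (hη.comp continuous_scaleBy)

lemma contractedInf_le (h0 : ∀ p, 0 ≤ η p) {l : ℕ → ℝ} (hl : l ∈ contractions) (p : A → ℝ) :
    contractedInf lev η p ≤ η (scaleBy lev l p) :=
  csInf_le ⟨0, by rintro _ ⟨l, -, rfl⟩; exact h0 _⟩ ⟨l, hl, rfl⟩

lemma contractedInf_le_self (h0 : ∀ p, 0 ≤ η p) (p : A → ℝ) : contractedInf lev η p ≤ η p := by
  have h1 : scaleBy lev (fun _ => 1) p = p := funext fun d => one_mul (p d)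
  have h2 := contractedInf_le (lev := lev) h0 one_mem_contractions p
  rwa [h1] at h2

lemma le_contractedInf {c : ℝ} {p : A → ℝ} (h : ∀ l ∈ contractions, c ≤ η (scaleBy lev l p)) :
    c ≤ contractedInf lev η p :=
  le_csInf (Set.Nonempty.image _ ⟨_, one_mem_contractions⟩)
    (by rintro _ ⟨l, hl, rfl⟩; exact h l hl)

lemma contractedInf_le_scaleBy (h0 : ∀ p, 0 ≤ η p) {l : ℕ → ℝ} (hl : l ∈ contractions)
    (p : A → ℝ) : contractedInf lev η p ≤ contractedInf lev η (scaleBy lev l p) := by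
  refine le_contractedInf fun l' hl' => ?_
  rw [scaleBy_scaleBy]
  refine contractedInf_le h0 ⟨fun m _ => ?_, ?_⟩ p
  · have h1 := hl.1 m trivial
    have h2 := hl'.1 m trivial
    exact ⟨mul_nonneg h2.1 h1.1, mul_le_one₀ h2.2 h1.1 h1.2⟩
  · have h1 : l 0 = 1 := hl.2
    have h2 : l' 0 = 1 := hl'.2
    simp [h1, h2]

end ContractedInf

/-- The gauge obtained from functions `η n` depending on the levels up to `n + 1`. -/
noncomputable def gaugeOf (lev : A → ℕ) (η : ℕ → (A → ℝ) → ℝ) (p : A → ℝ) : ℝ :=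
  dyadicSup fun n => contractedInf lev (η n) p / 2

variable {η : ℕ → (A → ℝ) → ℝ}

lemma contractedInf_div_two_mem (hη : ∀ n p, η n p ∈ Icc (0 : ℝ) 1) (p : A → ℝ) (n : ℕ) :
    contractedInf lev (η n) p / 2 ∈ Icc (0 : ℝ) 1 := by
  have h0 : 0 ≤ contractedInf lev (η n) p := le_contractedInf fun l _ => (hη n _).1
  have h1 := (contractedInf_le_self (lev := lev) (fun p => (hη n p).1) p).trans (hη n p).2
  exact ⟨by linarith, by linarith⟩

lemma gaugeOf_eq_zero (hη : ∀ n p, η n p ∈ Icc (0 : ℝ) 1) {p : A → ℝ} (hp : ∀ n, η n p = 0) :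
    gaugeOf lev η p = 0 := by
  have h : ∀ n, contractedInf lev (η n) p = 0 := fun n => le_antisymm
    (hp n ▸ contractedInf_le_self (fun p => (hη n p).1) p)
    (le_contractedInf fun l _ => (hη n _).1)
  exact le_antisymm (dyadicSup_le fun n => by simp [h])
    (dyadicSup_nonneg fun n => contractedInf_div_two_mem hη p n)

lemma isGauge_gaugeOf (hc : ∀ n, Continuous (η n)) (hη : ∀ n p, η n p ∈ Icc (0 : ℝ) 1)
    (hdep : ∀ n p p', (∀ d, lev d ≤ n + 1 → p d = p' d) → η n p = η n p')
    (hone : ∀ n p, (∀ d, lev d = n + 1 → p d = 0) → η n p = 1) : IsGauge lev (gaugeOf lev η) where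
  continuous := continuous_dyadicSup
    (fun n => (continuous_contractedInf (hc n)).div_const 2)
    (fun n p => contractedInf_div_two_mem hη p n)
  nonneg p := dyadicSup_nonneg (contractedInf_div_two_mem hη p)
  le_one p := dyadicSup_le fun n => by
    have h := contractedInf_div_two_mem (lev := lev) hη p n
    exact mul_le_one₀ (pow_le_one₀ (by norm_num) (by norm_num)) h.1 h.2
  le_scaleBy l p hl0 hl := dyadicSup_le fun n => by
    refine le_trans ?_ (le_dyadicSup (contractedInf_div_two_mem hη _) n)
    have := contractedInf_le_scaleBy (lev := lev) (fun p => (hη n p).1)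
      (⟨fun m _ => hl m, hl0⟩ : l ∈ contractions) p
    gcongr
  le_of_level_eq_zero p m hm hp := by
    obtain ⟨n, rfl⟩ := Nat.exists_eq_add_of_le' hm
    refine le_trans ?_ (le_dyadicSup (contractedInf_div_two_mem hη _) n)
    have h : 1 ≤ contractedInf lev (η n) p := le_contractedInf fun l _ =>
      (hone n _ fun d hd => by simp [scaleBy, hp d hd]).ge
    rw [pow_succ]
    gcongr
  eq_of_lt τ p p' hpp' hτ := by
    have key : ∀ n, contractedInf lev (η n) p = contractedInf lev (η n) p' ∨
        ∀ p, (1 / 2) ^ n * (contractedInf lev (η n) p / 2) ≤ τ := by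
      intro n
      by_cases hn : τ < (1 / 2) ^ (n + 1)
      · left
        have h : ∀ l, η n (scaleBy lev l p) = η n (scaleBy lev l p') := fun l =>
          hdep n _ _ fun d hd => by
            simp only [scaleBy, hpp' d (hn.trans_le (half_pow_anti hd))]
        simp only [contractedInf, h]
      · right
        intro p
        have h1 := (contractedInf_le_self (lev := lev) (fun p => (hη n p).1) p).trans (hη n p).2
        refine le_trans ?_ (not_lt.1 hn)
        rw [pow_succ]
        gcongr
    refine le_antisymm (dyadicSup_le fun n => ?_) ?_
    · rcases key n with h | h
      · rw [← h]
        exact le_dyadicSup (contractedInf_div_two_mem hη p) n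
      · exact (h p').trans hτ.le
    · have h : gaugeOf lev η p ≤ max (gaugeOf lev η p') τ := dyadicSup_le fun n => by
        rcases key n with h | h
        · rw [h]
          exact (le_dyadicSup (contractedInf_div_two_mem hη p') n).trans (le_max_left _ _)
        · exact (h p).trans (le_max_right _ _)
      exact (le_max_iff.1 h).resolve_right hτ.not_ge

end Gauge

section Shear

variable {A : Type u} {lev : A → ℕ} {a : (A → ℝ) → A → ℝ}

/-- A continuous map of `ℝ^A` each of whose coordinates depends only on the coordinates of
smaller level, and whose coordinates of level zero vanish. -/
structure IsTriangular (lev : A → ℕ) (a : (A → ℝ) → A → ℝ) : Prop where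
  continuous : Continuous a
  congr : ∀ d p p', (∀ e, lev e < lev d → p e = p' e) → a p d = a p' d
  level_zero : ∀ p d, lev d = 0 → a p d = 0

/-- The successive approximations to the solution `p` of `p - a p = q`. -/
def unshearSeq (a : (A → ℝ) → A → ℝ) (q : A → ℝ) : ℕ → A → ℝ
  | 0 => q
  | n + 1 => q + a (unshearSeq a q n)

/-- The solution `p` of `p - a p = q`, for a triangular map `a`. -/
def unshear (lev : A → ℕ) (a : (A → ℝ) → A → ℝ) (q : A → ℝ) : A → ℝ :=
  fun d => unshearSeq a q (lev d) d

lemma unshear_level_zero (q : A → ℝ) {d : A} (hd : lev d = 0) :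
    unshear lev a q d = q d := by
  rw [unshear, hd]
  rfl

namespace IsTriangular

lemma unshearSeq_eq (ha : IsTriangular lev a) (q : A → ℝ) (n : ℕ) :
    ∀ m d, lev d ≤ n → lev d ≤ m → unshearSeq a q n d = unshearSeq a q m d := by
  have h0 : ∀ m d, lev d = 0 → unshearSeq a q m d = q d := by
    rintro (_ | m) d hd
    · rfl
    · simp [unshearSeq, ha.level_zero _ d hd]
  induction n with
  | zero => intro m d hn _; rw [h0 0 d (by omega), h0 m d (by omega)]
  | succ n ih =>
    rintro (_ | m) d hn hm
    · rw [h0 _ d (by omega), h0 0 d (by omega)]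
    · simp only [unshearSeq, Pi.add_apply]
      rw [ha.congr d _ _ fun e he => ih m e (by omega) (by omega)]

lemma unshear_sub (ha : IsTriangular lev a) (q : A → ℝ) :
    unshear lev a q - a (unshear lev a q) = q := by
  rw [sub_eq_iff_eq_add]
  ext d
  rw [unshear, ha.unshearSeq_eq q _ (lev d + 1) d le_rfl (Nat.le_succ _)]
  simp only [unshearSeq, Pi.add_apply]
  rw [ha.congr d (unshearSeq a q (lev d)) (unshear lev a q) fun e he =>
    ha.unshearSeq_eq q _ _ e he.le le_rfl]

lemma eq_of_sub_eq (ha : IsTriangular lev a) {p p' : A → ℝ} {n : ℕ}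
    (h : ∀ d, lev d ≤ n → (p - a p) d = (p' - a p') d) : ∀ d, lev d ≤ n → p d = p' d := by
  intro d
  induction hm : lev d using Nat.strong_induction_on generalizing d with
  | _ m ih =>
    intro hd
    have h1 := h d (hm ▸ hd)
    simp only [Pi.sub_apply] at h1
    rw [ha.congr d p p' fun e he => ih _ (hm ▸ he) e rfl (by omega)] at h1
    linarith

lemma continuous_unshear (ha : IsTriangular lev a) : Continuous (unshear lev a) := by
  have h : ∀ n, Continuous fun q => unshearSeq a q n := by
    intro n
    induction n with
    | zero => exact continuous_id
    | succ n ih => exact continuous_id.add (ha.continuous.comp ih)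
  exact continuous_pi fun d => (continuous_apply d).comp (h (lev d))

/-- The homeomorphism `p ↦ p - a p`. -/
def shear (ha : IsTriangular lev a) : (A → ℝ) ≃ₜ (A → ℝ) where
  toFun p := p - a p
  invFun := unshear lev a
  left_inv p := funext fun d =>
    ha.eq_of_sub_eq (fun e _ => congrFun (ha.unshear_sub (p - a p)) e) d le_rfl
  right_inv := ha.unshear_sub
  continuous_toFun := continuous_id.sub ha.continuous
  continuous_invFun := ha.continuous_unshear

lemma unshear_congr (ha : IsTriangular lev a) {q q' : A → ℝ} {n : ℕ}
    (h : ∀ d, lev d ≤ n → q d = q' d) (d : A) (hd : lev d ≤ n) :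
    unshear lev a q d = unshear lev a q' d :=
  ha.eq_of_sub_eq (fun e he => by rw [ha.unshear_sub, ha.unshear_sub, h e he]) d hd

lemma exists_splitting (ha : IsTriangular lev a) {Z : Set (A → ℝ)} {φ : ℕ → (A → ℝ) → ℝ}
    (hc : ∀ n, Continuous (φ n)) (hφ : ∀ n p, φ n p ∈ Icc (0 : ℝ) 1)
    (hdep : ∀ n p p', (∀ d, lev d ≤ n + 1 → p d = p' d) → φ n p = φ n p')
    (hzero : ∀ n p, (∀ d, lev d = n + 1 → p d = a p d) → φ n p = 0)
    (hone : ∀ n, ∀ z ∈ Z, φ n z = 1) {e : ℕ × ℕ → A} (he : Function.Injective e)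
    (hlev : ∀ x, x.1 ≤ lev (e x)) (hpos : ∀ x, lev (e x) ≠ 0) :
    ∃ Θ : (A → ℝ) ≃ₜ (ℕ → ℝ) × (A → ℝ),
      (∀ z ∈ Z, Θ z = (0, z)) ∧ ∀ p d, lev d = 0 → (Θ p).2 d = p d := by
  set η : ℕ → (A → ℝ) → ℝ := fun n q => 1 - φ n (unshear lev a q) with hη_def
  have hη : ∀ n q, η n q ∈ Icc (0 : ℝ) 1 := fun n q =>
    ⟨by simp only [hη_def]; linarith [(hφ n (unshear lev a q)).2],
      by simp only [hη_def]; linarith [(hφ n (unshear lev a q)).1]⟩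
  have hω : IsGauge lev (gaugeOf lev η) := by
    refine isGauge_gaugeOf (fun n => continuous_const.sub ((hc n).comp ha.continuous_unshear)) hη
      (fun n p p' h => ?_) (fun n p h => ?_)
    · simp only [hη_def]
      rw [hdep n _ _ (ha.unshear_congr h)]
    · simp only [hη_def]
      rw [hzero n _ fun d hd => ?_, sub_zero]
      have := congrFun (ha.unshear_sub p) d
      rw [Pi.sub_apply, h d hd] at this
      linarith
  refine ⟨ha.shear.trans ((hω.splitOffHomeomorph he hlev).trans
    ((Homeomorph.refl _).prodCongr ha.shear.symm)), fun z hz => ?_, fun p d hd => ?_⟩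
  · have h0 : gaugeOf lev η (ha.shear z) = 0 := by
      refine gaugeOf_eq_zero hη fun n => ?_
      have : unshear lev a (ha.shear z) = z := ha.shear.symm_apply_apply z
      simp only [hη_def]
      rw [this, hone n z hz, sub_self]
    have h1 : hω.splitOffHomeomorph he hlev (ha.shear z) = (0, ha.shear z) :=
      splitOff_of_eq_zero he h0
    simp [h1]
  · have h1 := hω.splitOff_of_level_zero hpos (ha.shear p) hd
    have h2 : ha.shear p d = p d := by
      change p d - a p d = p d
      rw [ha.level_zero p d hd, sub_zero]
    exact (unshear_level_zero _ hd).trans (h1.trans h2)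

end IsTriangular

end Shear

section Sections

variable {A : Type u} {B : Set A} {Cseq : ℕ → Set A}

/-- The first `n` such that `d ∈ B ∪ Cseq n`. -/
noncomputable def level (B : Set A) (Cseq : ℕ → Set A) (d : A) : ℕ := sInf {n | d ∈ B ∪ Cseq n}

lemma level_le_iff (hmono : Monotone Cseq) (hcover : B ∪ (⋃ n, Cseq n) = univ) {d : A} {n : ℕ} :
    level B Cseq d ≤ n ↔ d ∈ B ∪ Cseq n := by
  refine ⟨fun h => ?_, fun h => Nat.sInf_le h⟩
  have hne : {n | d ∈ B ∪ Cseq n}.Nonempty := by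
    have hd : d ∈ B ∪ (⋃ n, Cseq n) := hcover ▸ mem_univ d
    rcases hd with hd | hd
    · exact ⟨0, Or.inl hd⟩
    · obtain ⟨n, hn⟩ := mem_iUnion.1 hd
      exact ⟨n, Or.inr hn⟩
  exact union_subset_union_right B (hmono h) (Nat.sInf_mem hne)

lemma level_eq_zero_iff (hmono : Monotone Cseq) (hcover : B ∪ (⋃ n, Cseq n) = univ)
    (hC0 : Cseq 0 = ∅) {d : A} : level B Cseq d = 0 ↔ d ∈ B := by
  rw [← Nat.le_zero, level_le_iff hmono hcover, hC0, union_empty]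

lemma resTo_eq_of_resSub_eq (hmono : Monotone Cseq) (hcover : B ∪ (⋃ n, Cseq n) = univ)
    {n : ℕ} {h : B ∪ Cseq n ⊆ B ∪ Cseq (n + 1)} {p : A → ℝ} {y : ↥(B ∪ Cseq (n + 1)) → ℝ}
    (hy : resSub h y = resTo (B ∪ Cseq n) p)
    (hp : ∀ d : ↥(B ∪ Cseq (n + 1)), level B Cseq d = n + 1 → p d = y d) :
    resTo (B ∪ Cseq (n + 1)) p = y := by
  ext d
  rcases ((level_le_iff hmono hcover).2 d.2).eq_or_lt with hd | hd
  · exact hp d hd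
  · exact (congrFun hy ⟨d, (level_le_iff hmono hcover).1 (Nat.lt_succ_iff.1 hd)⟩).symm

lemma continuous_resTo (D : Set A) : Continuous (resTo D) :=
  continuous_pi fun d => continuous_apply d.1

lemma exists_level_eq_succ (hmono : Monotone Cseq) (hcover : B ∪ (⋃ n, Cseq n) = univ)
    {Z : Set (A → ℝ)} (hZ : Z.Nonempty) {n : ℕ}
    {s : (↥(B ∪ Cseq n) → ℝ) → (↥(B ∪ Cseq (n + 1)) → ℝ)} {h : B ∪ Cseq n ⊆ B ∪ Cseq (n + 1)}
    (hsec : ∀ x, resSub h (s x) = x)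
    (hsep : FunctionallySeparated (range s) (resTo (B ∪ Cseq (n + 1)) '' Z)) :
    ∃ d, level B Cseq d = n + 1 := by
  by_contra! hne
  obtain ⟨z, hz⟩ := hZ
  obtain ⟨φ, -, -, h0, h1⟩ := hsep
  have hz1 := h1 _ ⟨z, hz, rfl⟩
  rw [resTo_eq_of_resSub_eq hmono hcover (hsec (resTo _ z)) fun d hd => absurd hd (hne d),
    h0 _ ⟨_, rfl⟩] at hz1
  exact zero_ne_one hz1

open Classical in
/-- The maps `s n` assembled to a map of `ℝ^A`. -/
noncomputable def assemble (hmono : Monotone Cseq) (hcover : B ∪ (⋃ n, Cseq n) = univ)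
    (s : ∀ n, (↥(B ∪ Cseq n) → ℝ) → (↥(B ∪ Cseq (n + 1)) → ℝ)) (p : A → ℝ) : A → ℝ := fun d =>
  if d ∈ B then 0 else s (level B Cseq d - 1) (resTo _ p)
    ⟨d, (level_le_iff hmono hcover).1 (by omega)⟩

variable {s : ∀ n, (↥(B ∪ Cseq n) → ℝ) → (↥(B ∪ Cseq (n + 1)) → ℝ)}

lemma isTriangular_assemble (hmono : Monotone Cseq) (hcover : B ∪ (⋃ n, Cseq n) = univ)
    (hC0 : Cseq 0 = ∅) (hs : ∀ n, Continuous (s n)) :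
    IsTriangular (level B Cseq) (assemble hmono hcover s) where
  continuous := by
    refine continuous_pi fun d => ?_
    by_cases hd : d ∈ B
    · simp only [assemble, hd, if_true]
      exact continuous_const
    · simp only [assemble, hd, if_false]
      exact (continuous_apply _).comp ((hs _).comp (continuous_resTo _))
  congr d p p' h := by
    by_cases hd : d ∈ B
    · simp only [assemble, hd, if_true]
    · have h0 : level B Cseq d ≠ 0 := fun h => hd ((level_eq_zero_iff hmono hcover hC0).1 h)
      have hr : resTo (B ∪ Cseq (level B Cseq d - 1)) p = resTo _ p' := funext fun e => by
        have := (level_le_iff hmono hcover).2 e.2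
        exact h e (by omega)
      simp only [assemble, hd, if_false, hr]
  level_zero p d hd := if_pos ((level_eq_zero_iff hmono hcover hC0).1 hd)

lemma assemble_of_level_eq (hmono : Monotone Cseq) (hcover : B ∪ (⋃ n, Cseq n) = univ)
    (hC0 : Cseq 0 = ∅) (p : A → ℝ) {n : ℕ} (d : ↥(B ∪ Cseq (n + 1)))
    (hd : level B Cseq d = n + 1) : assemble hmono hcover s p d = s n (resTo _ p) d := by
  have hB : d.1 ∉ B := fun h => by
    rw [(level_eq_zero_iff hmono hcover hC0).2 h] at hd
    omega
  have key : ∀ (m : ℕ) (h : d.1 ∈ B ∪ Cseq (m + 1)), m = n →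
      s m (resTo _ p) ⟨d, h⟩ = s n (resTo _ p) d := by
    rintro m h rfl
    rfl
  rw [assemble, if_neg hB]
  exact key _ _ (by omega)

lemma exists_splitting_of_separated_sections (hmono : Monotone Cseq)
    (hcover : B ∪ (⋃ n, Cseq n) = univ) (hC0 : Cseq 0 = ∅) {Z : Set (A → ℝ)}
    (hs : ∀ n, Continuous (s n)) {h : ∀ n, B ∪ Cseq n ⊆ B ∪ Cseq (n + 1)}
    (hsec : ∀ n x, resSub (h n) (s n x) = x)
    (hsep : ∀ n, FunctionallySeparated (range (s n)) (resTo (B ∪ Cseq (n + 1)) '' Z))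
    {e : ℕ × ℕ → A} (he : Function.Injective e) (hlev : ∀ x, x.1 ≤ level B Cseq (e x))
    (heB : ∀ x, e x ∉ B) :
    ∃ Θ : (A → ℝ) ≃ₜ (ℕ → ℝ) × (A → ℝ),
      (∀ z ∈ Z, Θ z = (0, z)) ∧ ∀ p, ∀ d ∈ B, (Θ p).2 d = p d := by
  choose φ hc hφ h0 h1 using hsep
  obtain ⟨Θ, hΘ, hΘ'⟩ := (isTriangular_assemble hmono hcover hC0 hs).exists_splitting
    (Z := Z) (φ := fun n p => φ n (resTo _ p)) (fun n => (hc n).comp (continuous_resTo _))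
    (fun n p => hφ n _)
    (fun n p p' h => congrArg (φ n) (funext fun d => h d ((level_le_iff hmono hcover).2 d.2)))
    (fun n p hp => h0 n _ ⟨resTo _ p, (resTo_eq_of_resSub_eq hmono hcover (hsec n _) fun d hd =>
      (hp d hd).trans (assemble_of_level_eq hmono hcover hC0 p d hd)).symm⟩)
    (fun n z hz => h1 n _ ⟨z, hz, rfl⟩) he hlev
    (fun x hx => heB x ((level_eq_zero_iff hmono hcover hC0).1 hx))
  exact ⟨Θ, hΘ, fun p d hd => hΘ' p d ((level_eq_zero_iff hmono hcover hC0).2 hd)⟩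

end Sections

section Exchange

variable {A : Type u} {B : Set A} (ε : ℕ ≃ ↥Bᶜ)

open Classical in
/-- The point with the coordinates of `p` in `B` and the coordinates `v` elsewhere. -/
noncomputable def glue (p : A → ℝ) (v : ℕ → ℝ) : A → ℝ := fun d =>
  if h : d ∈ B then p d else v (ε.symm ⟨d, h⟩)

/-- The coordinates of `p` outside `B`. -/
def offB (p : A → ℝ) : ℕ → ℝ := fun j => p (ε j)

lemma glue_of_mem (p : A → ℝ) (v : ℕ → ℝ) {d : A} (hd : d ∈ B) : glue ε p v d = p d := dif_pos hd

lemma offB_glue (p : A → ℝ) (v : ℕ → ℝ) : offB ε (glue ε p v) = v := by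
  ext j
  have : (ε j : A) ∉ B := (ε j).2
  simp [offB, glue, this]

lemma glue_eq {p x : A → ℝ} (h : ∀ d ∈ B, p d = x d) : glue ε p (offB ε x) = x := by
  ext d
  by_cases hd : d ∈ B
  · rw [glue_of_mem ε _ _ hd, h d hd]
  · simp [glue, hd, offB]

lemma continuous_glue {X : Type*} [TopologicalSpace X] {p : X → A → ℝ} {v : X → ℕ → ℝ}
    (hp : Continuous p) (hv : Continuous v) : Continuous fun x => glue ε (p x) (v x) := by
  refine continuous_pi fun d => ?_
  by_cases hd : d ∈ B
  · simp only [glue, hd, dif_pos]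
    exact (continuous_apply d).comp hp
  · simp only [glue, hd, dif_neg, not_false_eq_true]
    exact (continuous_apply _).comp hv

lemma continuous_offB : Continuous (offB ε) := continuous_pi fun _ => continuous_apply _

/-- The homeomorphism exchanging the extra sequence of coordinates with the coordinates outside
`B`, after shearing along `f` and `g`. It maps `(0, z)` to `(0, f z)` whenever `g (f z) = z`. -/
noncomputable def exchange {f g : (A → ℝ) → (A → ℝ)} (hf : Continuous f) (hg : Continuous g) :
    (ℕ → ℝ) × (A → ℝ) ≃ₜ (ℕ → ℝ) × (A → ℝ) where
  toFun x := (offB ε x.2 - offB ε (g (glue ε x.2 (x.1 + offB ε (f x.2)))),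
    glue ε x.2 (x.1 + offB ε (f x.2)))
  invFun y := (offB ε y.2 - offB ε (f (glue ε y.2 (y.1 + offB ε (g y.2)))),
    glue ε y.2 (y.1 + offB ε (g y.2)))
  left_inv x := by
    have h : ∀ w, glue ε (glue ε x.2 w) (offB ε x.2) = x.2 := fun w =>
      glue_eq ε fun d hd => glue_of_mem ε _ _ hd
    simp only [sub_add_cancel, h, offB_glue, add_sub_cancel_right]
  right_inv x := by
    have h : ∀ w, glue ε (glue ε x.2 w) (offB ε x.2) = x.2 := fun w =>
      glue_eq ε fun d hd => glue_of_mem ε _ _ hd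
    simp only [sub_add_cancel, h, offB_glue, add_sub_cancel_right]
  continuous_toFun := by
    have h1 := continuous_offB ε
    have h2 : Continuous fun x : (ℕ → ℝ) × (A → ℝ) => glue ε x.2 (x.1 + offB ε (f x.2)) :=
      continuous_glue ε continuous_snd (by fun_prop)
    exact ((h1.comp continuous_snd).sub (h1.comp (hg.comp h2))).prodMk h2
  continuous_invFun := by
    have h1 := continuous_offB ε
    have h2 : Continuous fun x : (ℕ → ℝ) × (A → ℝ) => glue ε x.2 (x.1 + offB ε (g x.2)) :=
      continuous_glue ε continuous_snd (by fun_prop)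
    exact ((h1.comp continuous_snd).sub (h1.comp (hf.comp h2))).prodMk h2

variable {f g : (A → ℝ) → (A → ℝ)} (hf : Continuous f) (hg : Continuous g)

lemma exchange_snd_of_mem (x : (ℕ → ℝ) × (A → ℝ)) {d : A} (hd : d ∈ B) :
    (exchange ε hf hg x).2 d = x.2 d := glue_of_mem ε _ _ hd

lemma exchange_zero {z : A → ℝ} (hgf : g (f z) = z) (hz : ∀ d ∈ B, f z d = z d) :
    exchange ε hf hg (0, z) = (0, f z) := by
  change (offB ε z - offB ε (g (glue ε z (0 + offB ε (f z)))),
    glue ε z (0 + offB ε (f z))) = (0, f z)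
  rw [zero_add, glue_eq ε fun d hd => (hz d hd).symm, hgf, sub_self]

end Exchange

/-- Given `B`-invariant maps `f, g` interchanging closed sets `Z, F ⊆ ℝ^{B∪C}` as mutually
inverse homeomorphisms, and sections `sₙ, rₙ` of the bonding projections whose images are
functionally separated from the projections of `Z`, resp. `F`, the homeomorphism `f|Z`
extends to a fiberwise (over `ℝ^B`) autohomeomorphism of `ℝ^{B∪C}`. -/
theorem unknotting_from_separated_sections
    (A : Type u) (B : Set A) (hB : B.Infinite)
    (Cseq : ℕ → Set A) (hCcount : ∀ n, (Cseq n).Countable)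
    (hCmono : ∀ n, Cseq n ⊆ Cseq (n + 1)) (hC0 : Cseq 0 = ∅)
    (hcover : B ∪ (⋃ n, Cseq n) = Set.univ)
    (Z F : Set (A → ℝ)) (hZcl : IsClosed Z) (hFcl : IsClosed F)
    (f g : (A → ℝ) → (A → ℝ)) (hfc : Continuous f) (hgc : Continuous g)
    (hfB : ∀ x, resTo B (f x) = resTo B x) (hgB : ∀ x, resTo B (g x) = resTo B x)
    (hfZ : f '' Z = F) (hgF : g '' F = Z)
    (hgf : ∀ z ∈ Z, g (f z) = z) (hfg : ∀ y ∈ F, f (g y) = y)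
    (s r : ∀ n, (↥(B ∪ Cseq n) → ℝ) → (↥(B ∪ Cseq (n + 1)) → ℝ))
    (hscont : ∀ n, Continuous (s n)) (hrcont : ∀ n, Continuous (r n))
    (hsSec : ∀ n x, resSub (Set.union_subset_union_right B (hCmono n)) (s n x) = x)
    (hrSec : ∀ n x, resSub (Set.union_subset_union_right B (hCmono n)) (r n x) = x)
    (hsSep : ∀ n, FunctionallySeparated (Set.range (s n)) (resTo (B ∪ Cseq (n + 1)) '' Z))
    (hrSep : ∀ n, FunctionallySeparated (Set.range (r n)) (resTo (B ∪ Cseq (n + 1)) '' F)) :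
    ∃ H : (A → ℝ) ≃ₜ (A → ℝ),
      (∀ x, resTo B (H x) = resTo B x) ∧ ∀ z ∈ Z, H z = f z := by
  rcases Z.eq_empty_or_nonempty with rfl | hZ
  · exact ⟨Homeomorph.refl _, fun _ => rfl, fun z hz => absurd hz (notMem_empty z)⟩
  have hmono : Monotone Cseq := monotone_nat_of_le_succ hCmono
  choose δ hδ using fun n => exists_level_eq_succ hmono hcover hZ (hsSec n) (hsSep n)
  have hδB : ∀ n, δ n ∉ B := fun n h => by
    have := hδ n
    rw [(level_eq_zero_iff hmono hcover hC0).2 h] at this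
    omega
  have hδinj : Function.Injective δ := fun m n h => by
    have := hδ m
    rw [h, hδ n] at this
    omega
  have : Countable ↥Bᶜ := by
    refine ((countable_iUnion hCcount).mono fun d hd => ?_).to_subtype
    have : d ∈ B ∪ ⋃ n, Cseq n := hcover ▸ mem_univ d
    exact this.resolve_left hd
  have : Infinite ↥Bᶜ := Infinite.of_injective (fun n => ⟨δ n, hδB n⟩) fun m n h =>
    hδinj (congrArg Subtype.val h)
  obtain ⟨ε⟩ : Nonempty (ℕ ≃ ↥Bᶜ) := nonempty_equiv_of_countable
  have he : Function.Injective fun x : ℕ × ℕ => δ (Nat.pair x.1 x.2) :=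
    hδinj.comp Nat.pairEquiv.injective
  have hlev : ∀ x : ℕ × ℕ, x.1 ≤ level B Cseq (δ (Nat.pair x.1 x.2)) := fun x => by
    rw [hδ]
    exact (Nat.left_le_pair _ _).trans (Nat.le_succ _)
  obtain ⟨Θ, hΘ, hΘB⟩ := exists_splitting_of_separated_sections hmono hcover hC0 hscont hsSec
    hsSep he hlev fun x => hδB _
  obtain ⟨Ψ, hΨ, hΨB⟩ := exists_splitting_of_separated_sections hmono hcover hC0 hrcont hrSec
    hrSep he hlev fun x => hδB _
  refine ⟨Θ.trans ((exchange ε hfc hgc).trans Ψ.symm), fun x => funext fun d => ?_,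
    fun z hz => ?_⟩
  · have h := hΨB (Ψ.symm (exchange ε hfc hgc (Θ x))) d d.2
    rw [Ψ.apply_symm_apply, exchange_snd_of_mem ε hfc hgc _ d.2, hΘB x d d.2] at h
    exact h.symm
  · simp only [Homeomorph.trans_apply]
    rw [hΘ z hz, exchange_zero ε hfc hgc (hgf z hz) fun d hd => congrFun (hfB z) ⟨d, hd⟩,
      ← hΨ _ (hfZ ▸ mem_image_of_mem f hz), Ψ.symm_apply_apply]
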